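/- Properties of the dual Cotton tensor in three dimensions: for n = 3 and every smooth symmetric field h_{μν} : ℝ^3 → ℝ, define 𝒞_{αβ}[h] = (1/2) η_{αρ} ε^{ρλμ} 𝒞_{βμλ}[h], where ε^{ρλμ} is the totally antisymmetric symbol with ε^{012} = 1. Then 𝒞_{αβ}[h] is symmetric (𝒞_{αβ} = 𝒞_{βα}), divergence-free (η^{αλ}∂_λ 𝒞_{αβ}[h] = 0), and traceless (η^{αβ}𝒞_{αβ}[h] = 0), at every point. -/

import Mathlib

noncomputable section

open MeasureTheory

/-- Minkowski metric `diag(-1,1,…,1)` on `Fin n`. -/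
def eta (n : ℕ) (μ ν : Fin n) : ℝ :=
  if μ = ν then (if (μ : ℕ) = 0 then -1 else 1) else 0

/-- Partial derivative in the coordinate direction `μ`. -/
def pd {n : ℕ} (μ : Fin n) (f : (Fin n → ℝ) → ℝ) : (Fin n → ℝ) → ℝ :=
  fun x => fderiv ℝ f x (Pi.single μ 1)

/-- A rank-2 covariant field on `ℝ^n`. -/
abbrev TensorField (n : ℕ) := Fin n → Fin n → (Fin n → ℝ) → ℝ

/-- Linearized Riemann tensor
`ℛ_{αβγδ}[h] = −(1/2)(∂_α∂_γ h_{βδ} + ∂_β∂_δ h_{αγ} − ∂_α∂_δ h_{βγ} − ∂_β∂_γ h_{αδ})`. -/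
def Riem {n : ℕ} (h : TensorField n) (α β γ δ : Fin n) : (Fin n → ℝ) → ℝ :=
  fun x => -(1/2) * (pd α (pd γ (h β δ)) x + pd β (pd δ (h α γ)) x
    - pd α (pd δ (h β γ)) x - pd β (pd γ (h α δ)) x)

/-- Linearized Ricci tensor
`ℛ_{μν}[h] = (1/2) η^{αλ}(∂_μ∂_α h_{λν} − ∂_λ∂_α h_{μν} − ∂_μ∂_ν h_{λα} + ∂_λ∂_ν h_{μα})`. -/
def Ricci {n : ℕ} (h : TensorField n) (μ ν : Fin n) : (Fin n → ℝ) → ℝ :=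
  fun x => (1/2) * ∑ α, ∑ l, eta n α l *
    (pd μ (pd α (h l ν)) x - pd l (pd α (h μ ν)) x
      - pd μ (pd ν (h l α)) x + pd l (pd ν (h μ α)) x)

/-- Linearized scalar curvature `ℛ[h] = η^{αλ}η^{μν}(∂_λ∂_ν h_{μα} − ∂_α∂_λ h_{μν})`. -/
def Scal {n : ℕ} (h : TensorField n) : (Fin n → ℝ) → ℝ :=
  fun x => ∑ α, ∑ l, ∑ μ, ∑ ν, eta n α l * eta n μ ν *
    (pd l (pd ν (h μ α)) x - pd α (pd l (h μ ν)) x)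

/-- Linearized Schouten-type tensor
`𝒦_{μν}[h] = (1/(n−2))(ℛ_{μν}[h] − η_{μν}ℛ[h]/(2(n−1)))`. -/
def Kt {n : ℕ} (h : TensorField n) (μ ν : Fin n) : (Fin n → ℝ) → ℝ :=
  fun x => (1 / ((n : ℝ) - 2)) *
    (Ricci h μ ν x - eta n μ ν * Scal h x / (2 * ((n : ℝ) - 1)))

/-- Linearized Weyl tensor
`𝒲_{αβγδ}[h] = ℛ_{αβγδ}[h] − η_{αγ}𝒦_{δβ}[h] + η_{αδ}𝒦_{γβ}[h] + η_{βγ}𝒦_{δα}[h] − η_{βδ}𝒦_{γα}[h]`. -/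
def Weyl {n : ℕ} (h : TensorField n) (α β γ δ : Fin n) : (Fin n → ℝ) → ℝ :=
  fun x => Riem h α β γ δ x - eta n α γ * Kt h δ β x + eta n α δ * Kt h γ β x
    + eta n β γ * Kt h δ α x - eta n β δ * Kt h γ α x

/-- Linearized Cotton tensor `𝒞_{αβμ}[h] = ∂_μ𝒦_{βα}[h] − ∂_β𝒦_{μα}[h]`. -/
def Cotton {n : ℕ} (h : TensorField n) (α β μ : Fin n) : (Fin n → ℝ) → ℝ :=
  fun x => pd μ (Kt h β α) x - pd β (Kt h μ α) x

/-- Cotton tensor with all indices raised: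
`𝒞^{αβρ}[h] = η^{αα'}η^{ββ'}η^{ρρ'}𝒞_{α'β'ρ'}[h]`. -/
def CottonUp {n : ℕ} (h : TensorField n) (α β ρ : Fin n) : (Fin n → ℝ) → ℝ :=
  fun x => ∑ α', ∑ β', ∑ ρ', eta n α α' * eta n β β' * eta n ρ ρ' * Cotton h α' β' ρ' x

/-- Linearized Bach tensor `ℬ^{αβ}[h] = −2∂_ρ𝒞^{αβρ}[h]`. -/
def Bach {n : ℕ} (h : TensorField n) (α β : Fin n) : (Fin n → ℝ) → ℝ :=
  fun x => -2 * ∑ ρ, pd ρ (CottonUp h α β ρ) x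

/-- Totally antisymmetric symbol on `Fin 3` with `ε^{012} = 1`. -/
def eps3 (i j k : Fin 3) : ℝ :=
  (((i : ℕ) : ℝ) - ((j : ℕ) : ℝ)) * (((j : ℕ) : ℝ) - ((k : ℕ) : ℝ))
    * (((k : ℕ) : ℝ) - ((i : ℕ) : ℝ)) / 2

/-- Dual Cotton tensor in three dimensions:
`𝒞_{αβ}[h] = (1/2) η_{αρ} ε^{ρλμ} 𝒞_{βμλ}[h]`. -/
def CottonDual (h : TensorField 3) (α β : Fin 3) : (Fin 3 → ℝ) → ℝ :=
  fun x => (1/2) * ∑ ρ, ∑ l, ∑ μ, eta 3 α ρ * eps3 ρ l μ * Cotton h β μ l x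

lemma contDiff_pd {n : ℕ} {f : (Fin n → ℝ) → ℝ} (μ : Fin n) (hf : ContDiff ℝ (⊤ : ℕ∞) f) :
    ContDiff ℝ (⊤ : ℕ∞) (pd μ f) := by
  unfold pd
  exact (hf.fderiv_right (m := (⊤ : ℕ∞)) le_rfl).clm_apply contDiff_const

lemma pd_comm {n : ℕ} {f : (Fin n → ℝ) → ℝ} (μ ν : Fin n) (hf : ContDiff ℝ (⊤ : ℕ∞) f) :
    pd μ (pd ν f) = pd ν (pd μ f) := by
  funext x
  have hd : DifferentiableAt ℝ (fderiv ℝ f) x :=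
    (hf.fderiv_right (m := (⊤ : ℕ∞)) le_rfl).differentiable (by simp) x
  have key : ∀ v w : Fin n → ℝ,
      fderiv ℝ (fun y => fderiv ℝ f y v) x w = fderiv ℝ (fderiv ℝ f) x w v := by
    intro v w
    rw [fderiv_clm_apply hd (differentiableAt_const v)]
    simp
  have hs : IsSymmSndFDerivAt ℝ f x :=
    hf.contDiffAt.isSymmSndFDerivAt (by
    rw [minSmoothness_of_isRCLikeNormedField]
    exact WithTop.coe_le_coe.2 le_top)
  unfold pd
  rw [key, key]
  exact hs _ _

section Linearity

variable {n : ℕ} {f g : (Fin n → ℝ) → ℝ} (μ : Fin n)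

lemma pd_add (hf : ContDiff ℝ (⊤ : ℕ∞) f) (hg : ContDiff ℝ (⊤ : ℕ∞) g) (x : Fin n → ℝ) :
    pd μ (fun y => f y + g y) x = pd μ f x + pd μ g x := by
  unfold pd
  rw [fderiv_fun_add (hf.differentiable (by simp) x) (hg.differentiable (by simp) x)]
  rfl

lemma pd_sub (hf : ContDiff ℝ (⊤ : ℕ∞) f) (hg : ContDiff ℝ (⊤ : ℕ∞) g) (x : Fin n → ℝ) :
    pd μ (fun y => f y - g y) x = pd μ f x - pd μ g x := by
  unfold pd
  rw [fderiv_fun_sub (hf.differentiable (by simp) x) (hg.differentiable (by simp) x)]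
  rfl

lemma pd_const_mul (c : ℝ) (hf : ContDiff ℝ (⊤ : ℕ∞) f) (x : Fin n → ℝ) :
    pd μ (fun y => c * f y) x = c * pd μ f x := by
  unfold pd
  rw [fderiv_const_mul (hf.differentiable (by simp) x)]
  rfl

lemma pd_sum {ι : Type*} (s : Finset ι) {F : ι → (Fin n → ℝ) → ℝ}
    (hF : ∀ i, ContDiff ℝ (⊤ : ℕ∞) (F i)) (x : Fin n → ℝ) :
    pd μ (fun y => ∑ i ∈ s, F i y) x = ∑ i ∈ s, pd μ (F i) x := by
  unfold pd
  rw [fderiv_fun_sum fun i _ => (hF i).differentiable (by simp) x]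
  simp

end Linearity

section Curvature

variable {n : ℕ} {h : TensorField n}

lemma contDiff_Ricci (hsmooth : ∀ μ ν, ContDiff ℝ (⊤ : ℕ∞) (h μ ν)) (μ ν : Fin n) :
    ContDiff ℝ (⊤ : ℕ∞) (Ricci h μ ν) := by
  have := fun α β μ ν => contDiff_pd α (contDiff_pd β (hsmooth μ ν))
  unfold Ricci
  fun_prop

lemma contDiff_Scal (hsmooth : ∀ μ ν, ContDiff ℝ (⊤ : ℕ∞) (h μ ν)) :
    ContDiff ℝ (⊤ : ℕ∞) (Scal h) := by
  have := fun α β μ ν => contDiff_pd α (contDiff_pd β (hsmooth μ ν))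
  unfold Scal
  fun_prop

lemma contDiff_Kt (hsmooth : ∀ μ ν, ContDiff ℝ (⊤ : ℕ∞) (h μ ν)) (μ ν : Fin n) :
    ContDiff ℝ (⊤ : ℕ∞) (Kt h μ ν) := by
  have := contDiff_Ricci hsmooth
  have := contDiff_Scal hsmooth
  unfold Kt
  fun_prop

lemma contDiff_Cotton (hsmooth : ∀ μ ν, ContDiff ℝ (⊤ : ℕ∞) (h μ ν)) (α β μ : Fin n) :
    ContDiff ℝ (⊤ : ℕ∞) (Cotton h α β μ) := by
  have := fun α μ ν => contDiff_pd α (contDiff_Kt hsmooth μ ν)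
  unfold Cotton
  fun_prop

lemma pd_Ricci (hsmooth : ∀ μ ν, ContDiff ℝ (⊤ : ℕ∞) (h μ ν)) (κ μ ν : Fin n)
    (x : Fin n → ℝ) :
    pd κ (Ricci h μ ν) x = (1/2) * ∑ α, ∑ l, eta n α l *
      (pd κ (pd μ (pd α (h l ν))) x - pd κ (pd l (pd α (h μ ν))) x
        - pd κ (pd μ (pd ν (h l α))) x + pd κ (pd l (pd ν (h μ α))) x) := by
  have := fun α β μ ν => contDiff_pd α (contDiff_pd β (hsmooth μ ν))
  unfold Ricci
  rw [pd_const_mul _ _ (by fun_prop), pd_sum _ _ (by fun_prop)]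
  congr 1
  refine Finset.sum_congr rfl fun α _ => ?_
  rw [pd_sum _ _ (by fun_prop)]
  refine Finset.sum_congr rfl fun l _ => ?_
  rw [pd_const_mul _ _ (by fun_prop), pd_add _ (by fun_prop) (by fun_prop),
    pd_sub _ (by fun_prop) (by fun_prop), pd_sub _ (by fun_prop) (by fun_prop)]

lemma pd_Scal (hsmooth : ∀ μ ν, ContDiff ℝ (⊤ : ℕ∞) (h μ ν)) (κ : Fin n) (x : Fin n → ℝ) :
    pd κ (Scal h) x = ∑ α, ∑ l, ∑ μ, ∑ ν, eta n α l * eta n μ ν *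
      (pd κ (pd l (pd ν (h μ α))) x - pd κ (pd α (pd l (h μ ν))) x) := by
  have := fun α β μ ν => contDiff_pd α (contDiff_pd β (hsmooth μ ν))
  unfold Scal
  rw [pd_sum _ _ (by fun_prop)]
  refine Finset.sum_congr rfl fun α _ => ?_
  rw [pd_sum _ _ (by fun_prop)]
  refine Finset.sum_congr rfl fun l _ => ?_
  rw [pd_sum _ _ (by fun_prop)]
  refine Finset.sum_congr rfl fun μ _ => ?_
  rw [pd_sum _ _ (by fun_prop)]
  refine Finset.sum_congr rfl fun ν _ => ?_
  rw [pd_const_mul _ _ (by fun_prop), pd_sub _ (by fun_prop) (by fun_prop)]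

lemma pd_Kt (hsmooth : ∀ μ ν, ContDiff ℝ (⊤ : ℕ∞) (h μ ν)) (κ μ ν : Fin n) (x : Fin n → ℝ) :
    pd κ (Kt h μ ν) x = (1 / ((n : ℝ) - 2)) *
      (pd κ (Ricci h μ ν) x - eta n μ ν * pd κ (Scal h) x / (2 * ((n : ℝ) - 1))) := by
  have := contDiff_Ricci hsmooth
  have := contDiff_Scal hsmooth
  unfold Kt
  simp only [mul_div_right_comm]
  rw [pd_const_mul _ _ (by fun_prop), pd_sub _ (by fun_prop) (by fun_prop),
    pd_const_mul _ _ (by fun_prop)]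

lemma pd_Cotton (hsmooth : ∀ μ ν, ContDiff ℝ (⊤ : ℕ∞) (h μ ν)) (κ α β μ : Fin n)
    (x : Fin n → ℝ) :
    pd κ (Cotton h α β μ) x = pd κ (pd μ (Kt h β α)) x - pd κ (pd β (Kt h μ α)) x := by
  have := fun α μ ν => contDiff_pd α (contDiff_Kt hsmooth μ ν)
  exact pd_sub _ (by fun_prop) (by fun_prop) x

end Curvature

section ThreeDimensional

variable {h : TensorField 3}

lemma pd_CottonDual (hsmooth : ∀ μ ν, ContDiff ℝ (⊤ : ℕ∞) (h μ ν)) (κ α β : Fin 3)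
    (x : Fin 3 → ℝ) :
    pd κ (CottonDual h α β) x =
      (1/2) * ∑ ρ, ∑ l, ∑ μ, eta 3 α ρ * eps3 ρ l μ * pd κ (Cotton h β μ l) x := by
  have := contDiff_Cotton hsmooth
  unfold CottonDual
  rw [pd_const_mul _ _ (by fun_prop), pd_sum _ _ (by fun_prop)]
  congr 1
  refine Finset.sum_congr rfl fun ρ _ => ?_
  rw [pd_sum _ _ (by fun_prop)]
  refine Finset.sum_congr rfl fun l _ => ?_
  rw [pd_sum _ _ (by fun_prop)]
  exact Finset.sum_congr rfl fun μ _ => pd_const_mul _ _ (by fun_prop) x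

lemma Kt_symm (hsmooth : ∀ μ ν, ContDiff ℝ (⊤ : ℕ∞) (h μ ν))
    (hsym : ∀ μ ν, h μ ν = h ν μ) (μ ν : Fin 3) : Kt h μ ν = Kt h ν μ := by
  have c10 := fun μ ν => pd_comm 1 0 (hsmooth μ ν)
  have c20 := fun μ ν => pd_comm 2 0 (hsmooth μ ν)
  have c21 := fun μ ν => pd_comm 2 1 (hsmooth μ ν)
  funext x
  fin_cases μ <;> fin_cases ν <;>
    simp [Kt, Ricci, Fin.sum_univ_three, eta, c10, c20, c21, hsym 1 0, hsym 2 0, hsym 2 1,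
      -mul_eq_mul_left_iff] <;>
    ring

/-- The contracted linearized Bianchi identity `η^{αλ}∂_λ𝒦_{αβ} = ∂_β(η^{αλ}𝒦_{αλ})`. -/
lemma div_Kt (hsmooth : ∀ μ ν, ContDiff ℝ (⊤ : ℕ∞) (h μ ν))
    (hsym : ∀ μ ν, h μ ν = h ν μ) (β : Fin 3) (x : Fin 3 → ℝ) :
    -pd 0 (Kt h 0 β) x + pd 1 (Kt h 1 β) x + pd 2 (Kt h 2 β) x =
      -pd β (Kt h 0 0) x + pd β (Kt h 1 1) x + pd β (Kt h 2 2) x := by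
  have c10 := fun μ ν => pd_comm 1 0 (hsmooth μ ν)
  have c20 := fun μ ν => pd_comm 2 0 (hsmooth μ ν)
  have c21 := fun μ ν => pd_comm 2 1 (hsmooth μ ν)
  have d10 := fun κ μ ν => pd_comm 1 0 (contDiff_pd κ (hsmooth μ ν))
  have d20 := fun κ μ ν => pd_comm 2 0 (contDiff_pd κ (hsmooth μ ν))
  have d21 := fun κ μ ν => pd_comm 2 1 (contDiff_pd κ (hsmooth μ ν))
  simp only [pd_Kt hsmooth, pd_Ricci hsmooth, pd_Scal hsmooth]
  fin_cases β <;>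
    simp [Fin.sum_univ_three, eta, c10, c20, c21, d10, d20, d21,
      hsym 1 0, hsym 2 0, hsym 2 1] <;>
    ring

end ThreeDimensional

/-- in three dimensions the dual Cotton tensor
`𝒞_{αβ}[h] = (1/2) η_{αρ} ε^{ρλμ} 𝒞_{βμλ}[h]` is symmetric, divergence-free
and traceless. -/
theorem dual_cotton_properties
    (h : TensorField 3) (hsmooth : ∀ μ ν, ContDiff ℝ (⊤ : ℕ∞) (h μ ν))
    (hsym : ∀ μ ν, h μ ν = h ν μ) :
    (∀ (α β : Fin 3) (x : Fin 3 → ℝ), CottonDual h α β x = CottonDual h β α x) ∧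
    (∀ (β : Fin 3) (x : Fin 3 → ℝ),
      ∑ α, ∑ l, eta 3 α l * pd l (CottonDual h α β) x = 0) ∧
    (∀ (x : Fin 3 → ℝ), ∑ α, ∑ β, eta 3 α β * CottonDual h α β x = 0) := by
  have hK := Kt_symm hsmooth hsym
  have K10 := hK 1 0
  have K20 := hK 2 0
  have K21 := hK 2 1
  refine ⟨fun α β x => ?_, fun β x => ?_, fun x => ?_⟩
  · have b0 := div_Kt hsmooth hsym 0 x
    have b1 := div_Kt hsmooth hsym 1 x
    have b2 := div_Kt hsmooth hsym 2 x
    fin_cases α <;> fin_cases β <;>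
      simp [CottonDual, Cotton, Fin.sum_univ_three, eta, eps3, K10, K20, K21] at b0 b1 b2 ⊢ <;>
      linarith
  · have c10 := fun μ ν => pd_comm 1 0 (contDiff_Kt hsmooth μ ν)
    have c20 := fun μ ν => pd_comm 2 0 (contDiff_Kt hsmooth μ ν)
    have c21 := fun μ ν => pd_comm 2 1 (contDiff_Kt hsmooth μ ν)
    simp only [pd_CottonDual hsmooth, pd_Cotton hsmooth]
    fin_cases β <;>
      simp [Fin.sum_univ_three, eta, eps3, c10, c20, c21] <;>
      ring
  · simp [CottonDual, Cotton, Fin.sum_univ_three, eta, eps3, K10, K20, K21]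
    ring
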